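/- arXiv:2506.17745 — 2 statements merged into one kernel-verified Lean document; each statement's English description precedes it below -/
import Mathlib

section
/- Let p ≥ 1 be an integer, q > p, b ≥ 0, and let λ be a finite signed Borel measure on ℝ^d satisfying ∫ x^α dλ(x) = 0 for all multi-indices α with |α| ≤ p−1 and ∫ |x|^q d|λ|(x) ≤ b^q. Then there is an absolute constant c > 0 such that for every r > 0, ‖λ‖_{ζ_p} ≤ c^p d^{p/2} ‖λ‖_{ζ_p(r)} + (1/p!) d^{q/2} (2/r)^{q−p} b^q. -/
open MeasureTheory
open scoped RealInnerProductSpace ENNReal NNReal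

noncomputable section


/-- The list of coordinate directions encoded by a multi-index `α` on `ℝ^d`:
the direction `i` is repeated `α i` times, so the list has length `|α| = ∑ i, α i`. -/
def multiIndexDirs {d : ℕ} (α : Fin d → ℕ) : List (Fin d) :=
  (List.finRange d).flatMap fun i => List.replicate (α i) i

/-- `D^α u (x)`: the partial derivative of `u` at `x` corresponding to the multi-index `α`
(of order `|α| = ∑ i, α i`), as an iterated derivative in the coordinate directions. -/
def mderiv {d : ℕ} (α : Fin d → ℕ) (u : EuclideanSpace ℝ (Fin d) → ℝ)
    (x : EuclideanSpace ℝ (Fin d)) : ℝ :=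
  iteratedFDeriv ℝ (multiIndexDirs α).length u x
    (fun k => EuclideanSpace.single ((multiIndexDirs α).get k) 1)


/-- The integral `∫ f dλ` of `f` with respect to a finite signed measure `λ`. -/
def sIntegral {X : Type*} [MeasurableSpace X] (lam : SignedMeasure X) (f : X → ℝ) : ℝ :=
  (∫ x, f x ∂lam.toJordanDecomposition.posPart) - ∫ x, f x ∂lam.toJordanDecomposition.negPart

/-- The total variation norm `‖λ‖_TV` of a finite signed measure `λ`. -/
def tvNorm {X : Type*} [MeasurableSpace X] (lam : SignedMeasure X) : ℝ :=
  (lam.totalVariation Set.univ).toReal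


/-- The Zolotarev semi-norm `‖λ‖_{ζ_p}` of a finite signed measure on `ℝ^d`:
the supremum of `|∫ u dλ|` over all `C^∞`-smooth `u : ℝ^d → ℝ` whose
partial derivatives of order `p` are bounded by `1` in absolute value. -/
def zolotarevSemi {d : ℕ} (p : ℕ) (lam : SignedMeasure (EuclideanSpace ℝ (Fin d))) : ℝ :=
  sSup { z | ∃ u : EuclideanSpace ℝ (Fin d) → ℝ, ContDiff ℝ (⊤ : ℕ∞) u ∧
    (∀ α : Fin d → ℕ, (∑ i, α i) = p → ∀ x, |mderiv α u x| ≤ 1) ∧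
    z = |sIntegral lam u| }


/-- The restricted Zolotarev semi-norm `‖λ‖_{ζ_p(r)}`: the supremum of `|∫ u dλ|` over the
class `U_r` of `C^∞`-smooth functions supported on the closed ball of radius `r` with
`D^α u(0) = 0` for `|α| ≤ p-1` and all partial derivatives of order `p` bounded by `1`. -/
def zolotarevSemiRestricted {d : ℕ} (p : ℕ) (r : ℝ)
    (lam : SignedMeasure (EuclideanSpace ℝ (Fin d))) : ℝ :=
  sSup { z | ∃ u : EuclideanSpace ℝ (Fin d) → ℝ, ContDiff ℝ (⊤ : ℕ∞) u ∧
    Function.support u ⊆ Metric.closedBall 0 r ∧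
    (∀ α : Fin d → ℕ, (∑ i, α i) ≤ p - 1 → mderiv α u 0 = 0) ∧
    (∀ α : Fin d → ℕ, (∑ i, α i) = p → ∀ x, |mderiv α u x| ≤ 1) ∧
    z = |sIntegral lam u| }


section GenericCalc

variable {E F : Type} [NormedAddCommGroup E] [NormedSpace ℝ E]
  [NormedAddCommGroup F] [NormedSpace ℝ F]

def dirD (f : E → F) : List E → E → F
  | [] => f
  | (v :: l) => fun x => fderiv ℝ (dirD f l) x v

lemma dirD_contDiff {f : E → F} (hf : ContDiff ℝ (⊤ : ℕ∞) f) (l : List E) :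
    ContDiff ℝ (⊤ : ℕ∞) (dirD f l) := by
  induction l with
  | nil => exact hf
  | cons v l ih =>
    have h1 : ContDiff ℝ (⊤ : ℕ∞) (fderiv ℝ (dirD f l)) :=
      ih.fderiv_right (by norm_cast)
    exact h1.clm_apply contDiff_const

lemma dirD_perm {f : E → F} (hf : ContDiff ℝ (⊤ : ℕ∞) f) {l l' : List E} (h : l.Perm l') :
    dirD f l = dirD f l' := by
  induction h with
  | nil => rfl
  | cons v _ ih => simp only [dirD, ih]
  | trans _ _ ih1 ih2 => exact ih1.trans ih2
  | swap v w l =>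
    funext x
    have hc := dirD_contDiff hf l
    have hs : IsSymmSndFDerivAt ℝ (dirD f l) x :=
      hc.contDiffAt.isSymmSndFDerivAt (by simpa using (WithTop.coe_le_coe.2 le_top : ((2 : ℕ∞) : WithTop ℕ∞) ≤ ((⊤ : ℕ∞) : WithTop ℕ∞)))
    have hd : DifferentiableAt ℝ (fderiv ℝ (dirD f l)) x :=
      ((hc.fderiv_right (m := (⊤ : ℕ∞)) (by norm_cast)).differentiable (by simp)).differentiableAt
    have key : ∀ a b : E, fderiv ℝ (fun y => fderiv ℝ (dirD f l) y a) x b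
        = fderiv ℝ (fderiv ℝ (dirD f l)) x b a := by
      intro a b
      have := (hd.hasFDerivAt.clm_apply (hasFDerivAt_const a x)).fderiv
      rw [this]; simp
    change fderiv ℝ (fun y => fderiv ℝ (dirD f l) y v) x w
      = fderiv ℝ (fun y => fderiv ℝ (dirD f l) y w) x v
    rw [key, key]
    exact hs.eq w v

lemma iteratedFDeriv_eq_dirD {f : E → F} (hf : ContDiff ℝ (⊤ : ℕ∞) f) (l : List E) (x : E) :
    iteratedFDeriv ℝ l.length f x l.get = dirD f l x := by
  induction l generalizing x with
  | nil => simp [dirD]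
  | cons v l ih =>
    have hd : DifferentiableAt ℝ (iteratedFDeriv ℝ l.length f) x :=
      (hf.differentiable_iteratedFDeriv (m := l.length)
        (by exact_mod_cast WithTop.coe_lt_coe.2 (ENat.natCast_lt_top l.length))).differentiableAt
    have e1 : iteratedFDeriv ℝ (v :: l).length f x (v :: l).get
        = fderiv ℝ (iteratedFDeriv ℝ l.length f) x v l.get := rfl
    have e2 : dirD f (v :: l) x = fderiv ℝ (dirD f l) x v := rfl
    have e3 : dirD f l = fun y => iteratedFDeriv ℝ l.length f y l.get := by
      funext y; exact (ih y).symm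
    rw [e1, e2, e3]
    have := (hd.hasFDerivAt.continuousMultilinear_apply_const l.get).fderiv
    rw [this]
    rfl

lemma iteratedFDeriv_ofFn {f : E → F} (hf : ContDiff ℝ (⊤ : ℕ∞) f) {k : ℕ} (v : Fin k → E) (x : E) :
    iteratedFDeriv ℝ k f x v = dirD f (List.ofFn v) x := by
  rw [← iteratedFDeriv_eq_dirD hf]
  have : ∀ (n : ℕ) (hn : n = k) (w : Fin n → E), (∀ i, w i = v (Fin.cast hn i)) →
      iteratedFDeriv ℝ k f x v = iteratedFDeriv ℝ n f x w := by
    intro n hn w hw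
    subst hn
    congr 1
    funext i
    simp [hw]
  apply this _ (List.length_ofFn)
  intro i
  simp
  rfl

lemma iteratedFDeriv_perm {f : E → F} (hf : ContDiff ℝ (⊤ : ℕ∞) f) {k : ℕ} (v : Fin k → E) (x : E)
    (σ : Equiv.Perm (Fin k)) :
    iteratedFDeriv ℝ k f x (fun i => v (σ i)) = iteratedFDeriv ℝ k f x v := by
  rw [iteratedFDeriv_ofFn hf, iteratedFDeriv_ofFn hf]
  exact congrFun (dirD_perm hf (Equiv.Perm.ofFn_comp_perm σ v)) x

/-- Taylor bound step. -/
lemma taylor_step {f : E → F} (hf : Differentiable ℝ f) (h0 : f 0 = 0) (n : ℕ)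
    (hb : ∀ x, ‖fderiv ℝ f x‖ ≤ ‖x‖ ^ n / (n.factorial : ℝ)) (x : E) :
    ‖f x‖ ≤ ‖x‖ ^ (n + 1) / ((n + 1).factorial : ℝ) := by
  have hd : ∀ t : ℝ, HasDerivAt (fun t : ℝ => f (t • x)) (fderiv ℝ f (t • x) x) t := by
    intro t
    have h1 : HasDerivAt (fun t : ℝ => t • x) x t := by
      simpa using (hasDerivAt_id t).smul_const x
    exact (hf (t • x)).hasFDerivAt.comp_hasDerivAt t h1
  have hB : ∀ t : ℝ, HasDerivAt (fun t : ℝ => t ^ (n + 1) * (‖x‖ ^ (n + 1) / ((n + 1).factorial : ℝ)))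
      (t ^ n * (‖x‖ ^ (n + 1) / (n.factorial : ℝ))) t := by
    intro t
    have := (hasDerivAt_pow (n + 1) t).mul_const (‖x‖ ^ (n + 1) / ((n + 1).factorial : ℝ))
    refine this.congr_deriv ?_
    rw [Nat.factorial_succ]
    push_cast
    have : (n.factorial : ℝ) ≠ 0 := by positivity
    have : (n : ℝ) + 1 ≠ 0 := by positivity
    field_simp
  have := image_norm_le_of_norm_deriv_right_le_deriv_boundary (a := 0) (b := 1)
    (f := fun t : ℝ => f (t • x)) (f' := fun t => fderiv ℝ f (t • x) x)
    (fun t _ => (hd t).continuousAt.continuousWithinAt)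
    (fun t _ => (hd t).hasDerivWithinAt) (by simp [h0]) hB ?_ (x := 1) (by simp)
  · simpa using this
  · intro t ht
    refine (ContinuousLinearMap.le_opNorm _ _).trans ?_
    have := hb (t • x)
    rw [norm_smul, Real.norm_of_nonneg ht.1] at this
    calc _ ≤ (t * ‖x‖) ^ n / (n.factorial : ℝ) * ‖x‖ := by gcongr
      _ = _ := by ring

lemma taylor_bound {f : E → F} (hf : ContDiff ℝ (⊤ : ℕ∞) f) (p : ℕ)
    (h0 : ∀ j < p, iteratedFDeriv ℝ j f 0 = 0) (hb : ∀ x, ‖iteratedFDeriv ℝ p f x‖ ≤ 1)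
    (n : ℕ) : ∀ j, j + n = p → ∀ x, ‖iteratedFDeriv ℝ j f x‖ ≤ ‖x‖ ^ n / (n.factorial : ℝ) := by
  induction n with
  | zero => intro j hj x; simp at hj; subst hj; simpa using hb x
  | succ n ih =>
    intro j hj x
    apply taylor_step
    · exact hf.differentiable_iteratedFDeriv (m := j)
        (by exact_mod_cast WithTop.coe_lt_coe.2 (ENat.natCast_lt_top j))
    · exact h0 j (by omega)
    · intro y
      have := ih (j + 1) (by omega) y
      rwa [← norm_fderiv_iteratedFDeriv] at this

lemma finite_series_deriv_zero (n : ℕ) : ∀ {F : Type} [NormedAddCommGroup F] [NormedSpace ℝ F]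
    {f : E → F} {q : FormalMultilinearSeries ℝ E F}, HasFiniteFPowerSeriesOnBall f q 0 n ⊤ →
    ∀ x, iteratedFDeriv ℝ n f x = 0 := by
  induction n with
  | zero =>
    intro F _ _ f q h x
    have : f = 0 := funext fun y => h.eq_zero_of_bound_zero y (by simp)
    subst this
    ext; simp
  | succ n ih =>
    intro F _ _ f q h x
    have := ih h.fderiv x
    rw [← norm_eq_zero, ← norm_iteratedFDeriv_fderiv, this, norm_zero]

def tpoly (f : E → F) (p : ℕ) (x : E) : F :=
  ∑ k ∈ Finset.range p, ((k.factorial : ℝ)⁻¹ • iteratedFDeriv ℝ k f 0) (fun _ => x)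

def tser (f : E → F) (p : ℕ) : FormalMultilinearSeries ℝ E F := fun k =>
  if k < p then (k.factorial : ℝ)⁻¹ • iteratedFDeriv ℝ k f 0 else 0

lemma tpoly_series (f : E → F) (p : ℕ) : HasFiniteFPowerSeriesOnBall (tpoly f p) (tser f p) 0 p ⊤ := by
  apply HasFiniteFPowerSeriesOnBall.mk'
  · intro m hm; simp [tser, Nat.not_lt.2 hm]
  · simp
  · intro y _
    simp only [zero_add, tpoly]
    apply Finset.sum_congr rfl
    intro k hk
    simp [tser, Finset.mem_range.1 hk]

lemma tpoly_deriv_zero (f : E → F) (p : ℕ) (x : E) : iteratedFDeriv ℝ p (tpoly f p) x = 0 :=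
  finite_series_deriv_zero p (tpoly_series f p) x

lemma tpoly_contDiff (f : E → F) (p : ℕ) : ContDiff ℝ (⊤ : ℕ∞) (tpoly f p) := by
  unfold tpoly
  apply ContDiff.sum
  intro k _
  exact (ContinuousMultilinearMap.contDiff _).comp (contDiff_pi.2 fun _ => contDiff_id)

lemma tpoly_deriv [CompleteSpace F] {f : E → F} (hf : ContDiff ℝ (⊤ : ℕ∞) f) {p k : ℕ} (hk : k < p) :
    iteratedFDeriv ℝ k (tpoly f p) 0 = iteratedFDeriv ℝ k f 0 := by
  ext v
  rw [(tpoly_series f p).toHasFPowerSeriesOnBall.iteratedFDeriv_eq_sum_of_completeSpace]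
  have : ∀ σ : Equiv.Perm (Fin k), tser f p k (fun i => v (σ i))
      = (k.factorial : ℝ)⁻¹ • iteratedFDeriv ℝ k f 0 v := by
    intro σ
    simp only [tser, hk, if_true, smul_apply]
    rw [iteratedFDeriv_perm hf]
  simp only [this, Finset.sum_const, Finset.card_univ, Fintype.card_perm, Fintype.card_fin]
  rw [← Nat.cast_smul_eq_nsmul ℝ, smul_smul, mul_inv_cancel₀ (by positivity), one_smul]

end GenericCalc
section Cutoff

lemma exists_step (δ : ℝ) (hδ : 0 < δ) (j : ℕ) : ∃ g : ℝ → ℝ, ContDiff ℝ (⊤ : ℕ∞) g ∧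
    (∀ t, 0 ≤ g t ∧ g t ≤ 1) ∧ (∀ t, t ≤ 1 / 4 → g t = 1) ∧
    (∀ t, 1 / 2 + j * δ ≤ t → g t = 0) ∧
    ∀ m ≤ j, ∀ t, |iteratedDeriv m g t| ≤ (2 / δ) ^ m := by
  induction j with
  | zero =>
    refine ⟨fun t => Real.smoothTransition (2 - 4 * t), ?_, ?_, ?_, ?_, ?_⟩
    · exact Real.smoothTransition.contDiff.comp (by fun_prop)
    · exact fun t => ⟨Real.smoothTransition.nonneg _, Real.smoothTransition.le_one _⟩
    · intro t ht
      exact Real.smoothTransition.one_of_one_le (by linarith)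
    · intro t ht
      exact Real.smoothTransition.zero_of_nonpos (by simp at ht; linarith)
    · intro m hm t
      obtain rfl : m = 0 := by omega
      simp only [iteratedDeriv_zero, pow_zero]
      rw [abs_of_nonneg (Real.smoothTransition.nonneg _)]
      exact Real.smoothTransition.le_one _
  | succ j ih =>
    obtain ⟨f, hf, h01, h1, h0, hm⟩ := ih
    have hc : Continuous f := hf.continuous
    have hi : ∀ a b, IntervalIntegrable f volume a b := fun a b => hc.intervalIntegrable a b
    let Φ : ℝ → ℝ := fun t => ∫ s in (0 : ℝ)..t, f s
    have hΦ : ∀ t, HasDerivAt Φ (f t) t := fun t =>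
      intervalIntegral.integral_hasDerivAt_right (hi _ _)
        (hc.stronglyMeasurableAtFilter _ _) hc.continuousAt
    have hg' : ∀ t, HasDerivAt (fun t => δ⁻¹ * (Φ t - Φ (t - δ))) (δ⁻¹ * (f t - f (t - δ))) t := by
      intro t
      exact ((hΦ t).sub ((hΦ (t - δ)).comp_sub_const t δ)).const_mul _
    have hge : ∀ t, Φ t - Φ (t - δ) = ∫ s in (t - δ)..t, f s := fun t =>
      intervalIntegral.integral_interval_sub_left (hi _ _) (hi _ _)
    have hderiv : deriv (fun t => δ⁻¹ * (Φ t - Φ (t - δ))) = fun t => δ⁻¹ * (f t - f (t - δ)) :=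
      funext fun t => (hg' t).deriv
    have hcd : ContDiff ℝ (⊤ : ℕ∞) (fun t => δ⁻¹ * (f t - f (t - δ))) := by
      have : ContDiff ℝ (⊤ : ℕ∞) (fun t => f (t - δ)) := hf.comp (contDiff_id.sub contDiff_const)
      exact contDiff_const.mul (hf.sub this)
    have hgv : ∀ t c, (∀ s ∈ Set.uIcc (t - δ) t, f s = c) → δ⁻¹ * (Φ t - Φ (t - δ)) = c := by
      intro t c h
      rw [hge, intervalIntegral.integral_congr h]
      simp
      field_simp
    have hg01 : ∀ t, 0 ≤ δ⁻¹ * (Φ t - Φ (t - δ)) ∧ δ⁻¹ * (Φ t - Φ (t - δ)) ≤ 1 := by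
      intro t
      constructor
      · rw [hge]
        have := intervalIntegral.integral_nonneg (μ := volume) (f := f) (a := t - δ) (b := t)
          (by linarith) (fun s _ => (h01 s).1)
        positivity
      · rw [hge]
        have := intervalIntegral.integral_mono_on (μ := volume) (f := f) (g := fun _ => 1)
          (a := t - δ) (b := t) (by linarith) (hi _ _) (by simp) (fun s _ => (h01 s).2)
        simp at this
        rw [inv_mul_le_iff₀ hδ]
        linarith
    refine ⟨fun t => δ⁻¹ * (Φ t - Φ (t - δ)), ?_, hg01, ?_, ?_, ?_⟩
    · rw [contDiff_infty_iff_deriv, hderiv]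
      exact ⟨fun t => (hg' t).differentiableAt, hcd⟩
    · intro t ht
      apply hgv
      intro s hs
      rw [Set.uIcc_of_le (by linarith)] at hs
      exact h1 s (by linarith [hs.2])
    · intro t ht
      apply hgv
      intro s hs
      rw [Set.uIcc_of_le (by linarith)] at hs
      push_cast at ht
      exact h0 s (by linarith [hs.1])
    · intro m hmj t
      cases m with
      | zero =>
        simp only [iteratedDeriv_zero, pow_zero]
        rw [abs_of_nonneg (hg01 t).1]
        exact (hg01 t).2
      | succ m =>
        have hm1 := hm m (by omega)
        have hfm : ContDiff ℝ m f := hf.of_le (by exact_mod_cast le_top)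
        rw [iteratedDeriv_succ', hderiv]
        have hsh : ContDiff ℝ m (fun t => f (t - δ)) := hfm.comp (contDiff_id.sub contDiff_const)
        have e : iteratedDeriv m (fun t => δ⁻¹ * (f t - f (t - δ))) t
            = δ⁻¹ * (iteratedDeriv m f t - iteratedDeriv m f (t - δ)) := by
          rw [iteratedDeriv_const_mul_field]
          have := iteratedDeriv_fun_sub (n := m) (x := t) hfm.contDiffAt hsh.contDiffAt
          rw [this, iteratedDeriv_comp_sub_const]
        rw [e, abs_mul, abs_of_pos (inv_pos.2 hδ)]
        have h3 : |iteratedDeriv m f t - iteratedDeriv m f (t - δ)| ≤ (2 / δ) ^ m + (2 / δ) ^ m :=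
          (abs_sub _ _).trans (add_le_add (hm1 _) (hm1 _))
        calc _ ≤ δ⁻¹ * ((2 / δ) ^ m + (2 / δ) ^ m) := by gcongr
          _ = _ := by rw [pow_succ]; ring

variable {E : Type} [NormedAddCommGroup E] [NormedSpace ℝ E]

lemma linear_iter_zero (L : E →L[ℝ] E →L[ℝ] ℝ) (x : E) (n : ℕ) :
    iteratedFDeriv ℝ (n + 2) (fun y => L y) x = 0 := by
  rw [← norm_eq_zero, ← norm_iteratedFDeriv_fderiv]
  have : fderiv ℝ (fun y => L y) = fun _ => L := funext fun y => L.fderiv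
  rw [this, iteratedFDeriv_succ_const]
  simp

lemma comp_bound {g : ℝ → ℝ} (hg : ContDiff ℝ (⊤ : ℕ∞) g) {h : E → ℝ} (hh : ContDiff ℝ (⊤ : ℕ∞) h)
    (L : E →L[ℝ] E →L[ℝ] ℝ) (hL : ∀ x, HasFDerivAt h (L x) x) {p : ℕ} (C r : ℝ) (hC : 1 ≤ C)
    (hr : 0 < r)
    (hgb : ∀ m ≤ p, ∀ t, |iteratedDeriv m g t| ≤ (C * p) ^ m)
    (x : E) (hx : ‖L x‖ ≤ 2 / r) (hLn : ‖L‖ ≤ 2 / r ^ 2) (k : ℕ) :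
    ∀ m, k + m ≤ p → ‖iteratedFDeriv ℝ k (fun y => iteratedDeriv m g (h y)) x‖
      ≤ (4 * C * p / r) ^ k * (C * p) ^ m := by
  induction k using Nat.strong_induction_on with
  | _ k ih =>
  intro m hkm
  have hgm : ∀ m : ℕ, ContDiff ℝ (⊤ : ℕ∞) (iteratedDeriv m g) := fun m =>
    by rw [iteratedDeriv_eq_iterate]; exact ContDiff.iterate_deriv m hg
  have hz : ∀ n, ‖iteratedFDeriv ℝ (n - n) (fun y => L y) x‖ ≤ 2 / r := by
    intro n
    rw [Nat.sub_self, norm_iteratedFDeriv_zero]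
    exact hx
  match k with
  | 0 => simpa using hgb m (by omega) (h x)
  | k + 1 =>
    have hfd : fderiv ℝ (fun y => iteratedDeriv m g (h y))
        = fun y => iteratedDeriv (m + 1) g (h y) • L y := by
      funext y
      have h1 : HasDerivAt (iteratedDeriv m g) (iteratedDeriv (m + 1) g (h y)) (h y) := by
        rw [iteratedDeriv_succ]
        exact ((hgm m).differentiable (by simp)).differentiableAt.hasDerivAt
      exact (h1.comp_hasFDerivAt y (hL y)).fderiv
    rw [← norm_iteratedFDeriv_fderiv, hfd]
    have hle := norm_iteratedFDeriv_smul_le (n := k) (𝕜 := ℝ) (𝕜' := ℝ)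
      (f := fun y => iteratedDeriv (m + 1) g (h y)) (g := fun y => L y) (N := (⊤ : ℕ∞))
      ((hgm _).comp hh) L.contDiff x (by exact_mod_cast le_top)
    refine hle.trans ?_
    have hp : (1 : ℝ) ≤ p := by exact_mod_cast (by omega : 1 ≤ p)
    match k with
    | 0 =>
      have := ih 0 (by omega) (m + 1) (by omega)
      simp only [zero_add, Finset.range_one, Finset.sum_singleton, Nat.choose_self, Nat.cast_one,
        one_mul, pow_one, norm_iteratedFDeriv_zero, pow_zero] at this ⊢
      have hz0 := hz 0
      calc _ ≤ (C * p) ^ (m + 1) * (2 / r) := by gcongr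
        _ = (2 * C * p / r) * (C * p) ^ m := by ring
        _ ≤ _ := by gcongr; norm_num
    | k + 1 =>
      have i1 := ih (k + 1) (by omega) (m + 1) (by omega)
      have i2 := ih k (by omega) (m + 1) (by omega)
      rw [Finset.sum_range_succ, Finset.sum_range_succ, Finset.sum_eq_zero]
      · have e1 : k + 1 - k = 1 := by omega
        rw [e1, norm_iteratedFDeriv_one]
        have e2 : fderiv ℝ (fun y => L y) x = L := L.fderiv
        rw [e2]
        simp only [Nat.choose_self, Nat.cast_one, one_mul,
          Nat.choose_succ_self_right, zero_add]
        have hk : ((k + 1 : ℕ) : ℝ) ≤ p := by exact_mod_cast (by omega)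
        have hz1 := hz (k + 1)
        calc _ ≤ p * ((4 * C * p / r) ^ k * (C * p) ^ (m + 1)) * (2 / r ^ 2) +
              ((4 * C * p / r) ^ (k + 1) * (C * p) ^ (m + 1)) * (2 / r) := by gcongr
          _ = (4 * C * p / r) ^ k * (C * p) ^ m * (C * p ^ 2 / r ^ 2 * (2 + 8 * C)) := by ring
          _ ≤ (4 * C * p / r) ^ k * (C * p) ^ m * (C * p ^ 2 / r ^ 2 * (16 * C)) := by
            gcongr; linarith
          _ = _ := by ring
      · intro i hi
        have := Finset.mem_range.1 hi
        obtain ⟨n, hn⟩ : ∃ n, k + 1 - i = n + 2 := ⟨k + 1 - i - 2, by omega⟩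
        rw [hn, linear_iter_zero]
        simp

end Cutoff
section Coord

abbrev EE1 (d : ℕ) := PiLp 1 (fun _ : Fin d => ℝ)

def ee (d : ℕ) : EE1 d ≃L[ℝ] EuclideanSpace ℝ (Fin d) :=
  (PiLp.continuousLinearEquiv 1 ℝ (fun _ : Fin d => ℝ)).trans
    (PiLp.continuousLinearEquiv 2 ℝ (fun _ : Fin d => ℝ)).symm

lemma ee_apply {d : ℕ} (y : EE1 d) (i : Fin d) : (ee d y) i = y i := rfl

lemma ee_symm_apply {d : ℕ} (y : EuclideanSpace ℝ (Fin d)) (i : Fin d) :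
    ((ee d).symm y) i = y i := rfl

lemma norm_ee1 {d : ℕ} (y : EE1 d) : ‖y‖ = ∑ i, |y i| := by
  rw [PiLp.norm_eq_of_L1]; rfl

lemma norm_ee_le {d : ℕ} (y : EE1 d) : ‖ee d y‖ ≤ ‖y‖ := by
  rw [EuclideanSpace.norm_eq, norm_ee1]
  apply Real.sqrt_le_iff.2
  refine ⟨by positivity, ?_⟩
  have := Finset.sum_sq_le_sq_sum_of_nonneg (s := Finset.univ) (f := fun i => |y i|)
    (fun i _ => abs_nonneg _)
  simpa [ee_apply] using this

lemma norm_le_ee {d : ℕ} (y : EE1 d) : ‖y‖ ≤ Real.sqrt d * ‖ee d y‖ := by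
  rw [EuclideanSpace.norm_eq, norm_ee1, ← Real.sqrt_mul (by positivity)]
  apply Real.le_sqrt_of_sq_le
  have := sq_sum_le_card_mul_sum_sq (s := Finset.univ) (f := fun i => |y i|)
  simpa [ee_apply] using this

def bb {d : ℕ} (i : Fin d) : EE1 d := (ee d).symm (EuclideanSpace.single i 1)

lemma ee_bb {d : ℕ} (i : Fin d) : ee d (bb i) = EuclideanSpace.single i 1 := by
  simp [bb]

lemma norm_bb {d : ℕ} (i : Fin d) : ‖bb i‖ = 1 := by
  rw [norm_ee1]
  simp only [bb, ee_symm_apply, PiLp.single_apply]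
  rw [Finset.sum_eq_single i]
  · simp
  · intro j _ hj; simp [hj]
  · simp

lemma sum_bb {d : ℕ} (y : EE1 d) : y = ∑ i, y i • bb i := by
  ext j
  simp [bb, ee_symm_apply]

lemma mi_count {d : ℕ} (α : Fin d → ℕ) (a : Fin d) : (multiIndexDirs α).count a = α a := by
  unfold multiIndexDirs
  rw [List.count_flatMap]
  have := Fin.sum_univ_def (fun i => (List.count a ∘ fun i => List.replicate (α i) i) i)
  rw [← this]
  simp [List.count_replicate]

lemma mi_length {d : ℕ} (α : Fin d → ℕ) : (multiIndexDirs α).length = ∑ i, α i := by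
  unfold multiIndexDirs
  rw [List.length_flatMap, Fin.sum_univ_def]
  simp

lemma mderiv_eq {d : ℕ} {u : EuclideanSpace ℝ (Fin d) → ℝ} (hu : ContDiff ℝ (⊤ : ℕ∞) u)
    (α : Fin d → ℕ) (x : EuclideanSpace ℝ (Fin d)) :
    mderiv α u x = dirD u ((multiIndexDirs α).map (fun i => EuclideanSpace.single i 1)) x := by
  unfold mderiv
  rw [iteratedFDeriv_ofFn hu]
  congr 1
  conv_rhs => rw [← List.ofFn_get (multiIndexDirs α), List.map_ofFn]
  rfl

lemma iter_ee {d : ℕ} {u : EuclideanSpace ℝ (Fin d) → ℝ} (hu : ContDiff ℝ (⊤ : ℕ∞) u)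
    (k : ℕ) (y : EE1 d) (v : Fin k → EE1 d) :
    iteratedFDeriv ℝ k (u ∘ ee d) y v = iteratedFDeriv ℝ k u (ee d y) (fun i => ee d (v i)) := by
  have := ((ee d : EE1 d →L[ℝ] EuclideanSpace ℝ (Fin d))).iteratedFDeriv_comp_right hu y (i := k)
    (by exact_mod_cast le_top)
  have h2 : iteratedFDeriv ℝ k (u ∘ ee d) y = (iteratedFDeriv ℝ k u ((ee d) y)).compContinuousLinearMap
    (fun _ => (ee d : EE1 d →L[ℝ] EuclideanSpace ℝ (Fin d))) := this
  rw [h2]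
  rfl

lemma norm_iter_le {d : ℕ} {u : EuclideanSpace ℝ (Fin d) → ℝ} (hu : ContDiff ℝ (⊤ : ℕ∞) u)
    (k : ℕ) (y : EE1 d) (c : ℝ) (hc : 0 ≤ c)
    (h : ∀ α : Fin d → ℕ, (∑ i, α i) = k → |mderiv α u (ee d y)| ≤ c) :
    ‖iteratedFDeriv ℝ k (u ∘ ee d) y‖ ≤ c := by
  have key : ∀ I : Fin k → Fin d, |iteratedFDeriv ℝ k (u ∘ ee d) y (fun j => bb (I j))| ≤ c := by
    intro I
    rw [iter_ee hu]
    simp only [ee_bb]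
    rw [iteratedFDeriv_ofFn hu]
    have e1 : List.ofFn (fun j => EuclideanSpace.single (I j) (1 : ℝ))
        = (List.ofFn I).map (fun i => EuclideanSpace.single i 1) := by
      rw [List.map_ofFn]; rfl
    let α : Fin d → ℕ := fun i => (List.ofFn I).count i
    have hperm : (List.ofFn I).Perm (multiIndexDirs α) :=
      List.perm_iff_count.2 fun a => (mi_count α a).symm
    rw [e1, dirD_perm hu (hperm.map _), ← mderiv_eq hu]
    apply h
    rw [← mi_length, ← hperm.length_eq, List.length_ofFn]
  refine ContinuousMultilinearMap.opNorm_le_bound hc ?_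
  intro v
  have hv : v = fun j => ∑ i, v j i • bb i := funext fun j => sum_bb (v j)
  have e : iteratedFDeriv ℝ k (u ∘ ee d) y v = ∑ I : Fin k → Fin d,
      (∏ j, v j (I j)) * iteratedFDeriv ℝ k (u ∘ ee d) y (fun j => bb (I j)) := by
    conv_lhs => rw [hv]
    rw [ContinuousMultilinearMap.map_sum]
    refine Finset.sum_congr rfl fun I _ => ?_
    rw [ContinuousMultilinearMap.map_smul_univ, smul_eq_mul]
  rw [e]
  calc _ ≤ ∑ I : Fin k → Fin d, (∏ j, |v j (I j)|) * c := by
        refine (norm_sum_le _ _).trans (Finset.sum_le_sum fun I _ => ?_)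
        rw [norm_mul, Real.norm_eq_abs, Real.norm_eq_abs, Finset.abs_prod]
        exact mul_le_mul_of_nonneg_left (key I) (by positivity)
    _ = c * ∏ j, ‖v j‖ := by
        rw [← Finset.sum_mul, mul_comm]
        congr 1
        simp only [norm_ee1]
        rw [Finset.prod_univ_sum]
        simp

lemma mderiv_le {d : ℕ} {u : EuclideanSpace ℝ (Fin d) → ℝ} (hu : ContDiff ℝ (⊤ : ℕ∞) u)
    (α : Fin d → ℕ) (y : EE1 d) :
    |mderiv α u (ee d y)| ≤ ‖iteratedFDeriv ℝ (∑ i, α i) (u ∘ ee d) y‖ := by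
  rw [← mi_length]
  have : mderiv α u (ee d y) = iteratedFDeriv ℝ (multiIndexDirs α).length (u ∘ ee d) y
      (fun k => bb ((multiIndexDirs α).get k)) := by
    rw [iter_ee hu]
    simp only [ee_bb]
    rfl
  rw [this]
  have h := ContinuousMultilinearMap.le_opNorm
    (iteratedFDeriv ℝ (multiIndexDirs α).length (u ∘ ee d) y)
    (fun k => bb ((multiIndexDirs α).get k))
  simpa only [norm_bb, Finset.prod_const_one, mul_one, Real.norm_eq_abs] using h

lemma tpoly_coord {d : ℕ} (f : EE1 d → ℝ) (p : ℕ) : ∃ c : (k : ℕ) → (Fin k → Fin d) → ℝ,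
    ∀ x : EuclideanSpace ℝ (Fin d), tpoly f p ((ee d).symm x) = ∑ k ∈ Finset.range p,
      ∑ I : Fin k → Fin d, c k I * ∏ i, x i ^ ((List.ofFn I).count i) := by
  refine ⟨fun k I => ((k.factorial : ℝ)⁻¹ • iteratedFDeriv ℝ k f 0) (fun j => bb (I j)), fun x => ?_⟩
  unfold tpoly
  refine Finset.sum_congr rfl fun k _ => ?_
  conv_lhs => rw [sum_bb ((ee d).symm x)]
  rw [ContinuousMultilinearMap.map_sum]
  refine Finset.sum_congr rfl fun I _ => ?_
  rw [ContinuousMultilinearMap.map_smul_univ, smul_eq_mul, mul_comm]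
  congr 1
  rw [← List.prod_ofFn]
  have := Finset.prod_list_map_count (List.ofFn I) (fun i => x i)
  rw [List.map_ofFn] at this
  change (List.ofFn ((fun i => x i) ∘ I)).prod = _
  rw [this]
  refine Finset.prod_subset (Finset.subset_univ _) fun i _ hi => ?_
  rw [List.mem_toFinset] at hi
  rw [List.count_eq_zero_of_not_mem hi, pow_zero]

end Coord
section MainEst

lemma exists_cutoff (d p : ℕ) (hp : 1 ≤ p) (r : ℝ) (hr : 0 < r) : ∃ w : EE1 d → ℝ,
    ContDiff ℝ (⊤ : ℕ∞) w ∧ (∀ y, 0 ≤ w y ∧ w y ≤ 1) ∧ (∀ y, ‖ee d y‖ ≤ r / 2 → w y = 1) ∧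
    (∀ y, r ≤ ‖ee d y‖ → w y = 0) ∧
    ∀ k ≤ p, ∀ y, ‖ee d y‖ ≤ r → ‖iteratedFDeriv ℝ k w y‖ ≤ (32 * p / r) ^ k := by
  have hp' : (0 : ℝ) < p := by exact_mod_cast hp
  obtain ⟨g, hg, h01, h1, h0, hb⟩ := exists_step (1 / (4 * p)) (by positivity) p
  let A : EE1 d →L[ℝ] EuclideanSpace ℝ (Fin d) := (ee d : EE1 d →L[ℝ] EuclideanSpace ℝ (Fin d))
  let L : EE1 d →L[ℝ] EE1 d →L[ℝ] ℝ := (2 / r ^ 2) • (innerSL ℝ).bilinearComp A A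
  have hLa : ∀ x v, L x v = 2 / r ^ 2 * inner ℝ (ee d x) (ee d v) := fun x v => rfl
  have hLb : ∀ x v, ‖L x v‖ ≤ 2 / r ^ 2 * ‖ee d x‖ * ‖v‖ := by
    intro x v
    rw [hLa, norm_mul, Real.norm_of_nonneg (by positivity), mul_assoc]
    gcongr
    exact (norm_inner_le_norm _ _).trans (by gcongr; exact norm_ee_le v)
  let h : EE1 d → ℝ := fun y => (r ^ 2)⁻¹ * ‖ee d y‖ ^ 2
  have hh : ContDiff ℝ (⊤ : ℕ∞) h := contDiff_const.mul ((ee d).contDiff.norm_sq ℝ)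
  have hL : ∀ x, HasFDerivAt h (L x) x := by
    intro x
    have h1 : HasFDerivAt (fun y => ee d y) A x := A.hasFDerivAt
    have h2 := h1.norm_sq.const_mul (r ^ 2)⁻¹
    refine h2.congr_fderiv ?_
    ext v
    rw [hLa]
    simp [A]
    ring
  refine ⟨fun y => g (h y), hg.comp hh, fun y => h01 _, ?_, ?_, ?_⟩
  · intro y hy
    apply h1
    change (r ^ 2)⁻¹ * ‖ee d y‖ ^ 2 ≤ 1 / 4
    rw [inv_mul_le_iff₀ (by positivity)]
    calc ‖ee d y‖ ^ 2 ≤ (r / 2) ^ 2 := by gcongr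
      _ = _ := by ring
  · intro y hy
    apply h0
    have : (1 : ℝ) / 2 + p * (1 / (4 * p)) = 3 / 4 := by field_simp; norm_num
    rw [this]
    change 3 / 4 ≤ (r ^ 2)⁻¹ * ‖ee d y‖ ^ 2
    rw [le_inv_mul_iff₀ (by positivity)]
    calc r ^ 2 * (3 / 4) ≤ r ^ 2 := by nlinarith [sq_nonneg r]
      _ ≤ _ := by gcongr
  · intro k hk y hy
    have := comp_bound hg hh L hL (p := p) 8 r (by norm_num) hr ?_ y ?_ ?_ k 0 (by omega)
    · simp only [iteratedDeriv_zero, pow_zero, mul_one] at this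
      convert this using 3
      norm_num
    · intro m hm t
      convert hb m hm t using 2
      field_simp
      norm_num
    · refine ContinuousLinearMap.opNorm_le_bound _ (by positivity) fun v => ?_
      refine (hLb y v).trans ?_
      gcongr
      calc 2 / r ^ 2 * ‖ee d y‖ ≤ 2 / r ^ 2 * r := by gcongr
        _ = _ := by field_simp
    · refine ContinuousLinearMap.opNorm_le_bound _ (by positivity) fun x => ?_
      refine ContinuousLinearMap.opNorm_le_bound _ (by positivity) fun v => ?_
      refine (hLb x v).trans ?_
      gcongr
      exact norm_ee_le x

lemma prod_bound {d p : ℕ} (hd : 1 ≤ d) {r : ℝ} (hr : 0 < r) {w V : EE1 d → ℝ}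
    (hw : ContDiff ℝ (⊤ : ℕ∞) w) (hw0 : ∀ y, r ≤ ‖ee d y‖ → w y = 0)
    (hwb : ∀ k ≤ p, ∀ y, ‖ee d y‖ ≤ r → ‖iteratedFDeriv ℝ k w y‖ ≤ (32 * p / r) ^ k)
    (hV : ContDiff ℝ (⊤ : ℕ∞) V) (hV0 : ∀ j < p, iteratedFDeriv ℝ j V 0 = 0)
    (hV1 : ∀ x, ‖iteratedFDeriv ℝ p V x‖ ≤ 1) (y : EE1 d) :
    ‖iteratedFDeriv ℝ p (fun y => V y * w y) y‖ ≤ (2 * Real.exp 32) ^ p * Real.sqrt d ^ p := by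
  by_cases hy : ‖ee d y‖ ≤ r
  · refine (norm_iteratedFDeriv_mul_le hV hw y (n := p) (by exact_mod_cast le_top)).trans ?_
    have hs : (1 : ℝ) ≤ Real.sqrt d := Real.one_le_sqrt.2 (by exact_mod_cast hd)
    have hterm : ∀ i ∈ Finset.range (p + 1), (p.choose i : ℝ) * ‖iteratedFDeriv ℝ i V y‖ *
        ‖iteratedFDeriv ℝ (p - i) w y‖ ≤ (p.choose i : ℝ) * (Real.sqrt d ^ p * Real.exp (32 * p)) := by
      intro i hi
      have hi' : i ≤ p := by have := Finset.mem_range.1 hi; omega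
      have h1 := taylor_bound hV p hV0 hV1 (p - i) i (by omega) y
      have h2 := hwb (p - i) (by omega) y hy
      have h3 : ‖y‖ ≤ Real.sqrt d * r := (norm_le_ee y).trans (by gcongr)
      have h4 : p - i ≤ p := by omega
      generalize p - i = n at *
      rw [mul_assoc]
      refine mul_le_mul_of_nonneg_left ?_ (by positivity)
      calc _ ≤ ((Real.sqrt d * r) ^ n / (n.factorial : ℝ)) * (32 * p / r) ^ n := by
            gcongr
            exact h1.trans (by gcongr)
        _ = Real.sqrt d ^ n * ((32 * p) ^ n / (n.factorial : ℝ)) := by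
            rw [mul_pow, div_pow]
            field_simp
        _ ≤ _ := by
            gcongr
            exact Real.pow_div_factorial_le_exp _ (by positivity) _
    refine (Finset.sum_le_sum hterm).trans ?_
    rw [← Finset.sum_mul, ← Nat.cast_sum, Nat.sum_range_choose, mul_comm (32 : ℝ), Real.exp_nat_mul]
    push_cast
    rw [mul_pow]
    apply le_of_eq; ring
  · have : (fun y => V y * w y) =ᶠ[nhds y] fun _ => 0 := by
      have ho : IsOpen {z : EE1 d | r < ‖ee d z‖} :=
        isOpen_lt continuous_const (ee d).continuous.norm
      filter_upwards [ho.mem_nhds (not_le.1 hy)] with z hz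
      rw [hw0 z (le_of_lt hz), mul_zero]
    rw [this.iteratedFDeriv ℝ p |>.eq_of_nhds]
    have h0 : iteratedFDeriv ℝ p (fun _ : EE1 d => (0 : ℝ)) y = 0 := by
      ext; simp
    rw [h0, norm_zero]
    positivity

end MainEst
section Integrals

variable {d : ℕ} {lam : SignedMeasure (EuclideanSpace ℝ (Fin d))}

lemma int_parts {f : EuclideanSpace ℝ (Fin d) → ℝ} (hf : Integrable f lam.totalVariation) :
    Integrable f lam.toJordanDecomposition.posPart ∧
      Integrable f lam.toJordanDecomposition.negPart := by
  rw [SignedMeasure.totalVariation, integrable_add_measure] at hf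
  exact hf

lemma sIntegral_add {f g : EuclideanSpace ℝ (Fin d) → ℝ} (hf : Integrable f lam.totalVariation)
    (hg : Integrable g lam.totalVariation) :
    sIntegral lam (fun x => f x + g x) = sIntegral lam f + sIntegral lam g := by
  unfold sIntegral
  rw [integral_add (int_parts hf).1 (int_parts hg).1, integral_add (int_parts hf).2 (int_parts hg).2]
  ring

lemma sIntegral_const_mul (c : ℝ) (f : EuclideanSpace ℝ (Fin d) → ℝ) :
    sIntegral lam (fun x => c * f x) = c * sIntegral lam f := by
  unfold sIntegral
  rw [integral_const_mul, integral_const_mul]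
  ring

lemma sIntegral_sum {ι : Type*} (s : Finset ι) {f : ι → EuclideanSpace ℝ (Fin d) → ℝ}
    (hf : ∀ i ∈ s, Integrable (f i) lam.totalVariation) :
    sIntegral lam (fun x => ∑ i ∈ s, f i x) = ∑ i ∈ s, sIntegral lam (f i) := by
  unfold sIntegral
  rw [integral_finsetSum _ (fun i hi => (int_parts (hf i hi)).1),
    integral_finsetSum _ (fun i hi => (int_parts (hf i hi)).2), Finset.sum_sub_distrib]

lemma sIntegral_le {f g : EuclideanSpace ℝ (Fin d) → ℝ} (hg : Integrable g lam.totalVariation)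
    (hfg : ∀ x, |f x| ≤ g x) : |sIntegral lam f| ≤ ∫ x, g x ∂lam.totalVariation := by
  unfold sIntegral
  have h := int_parts hg
  have e : ∫ x, g x ∂lam.totalVariation = ∫ x, g x ∂lam.toJordanDecomposition.posPart +
      ∫ x, g x ∂lam.toJordanDecomposition.negPart := by
    rw [SignedMeasure.totalVariation, integral_add_measure h.1 h.2]
  rw [e]
  refine (abs_sub _ _).trans (add_le_add ?_ ?_)
  · rw [← Real.norm_eq_abs]
    exact norm_integral_le_of_norm_le h.1 (Filter.Eventually.of_forall fun x => by
      simpa only [Real.norm_eq_abs] using hfg x)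
  · rw [← Real.norm_eq_abs]
    exact norm_integral_le_of_norm_le h.2 (Filter.Eventually.of_forall fun x => by
      simpa only [Real.norm_eq_abs] using hfg x)

lemma int_rpow {q b : ℝ} (hq : 0 ≤ q) (hb : 0 ≤ b)
    (h : ∫⁻ x, (‖x‖₊ : ℝ≥0∞) ^ q ∂lam.totalVariation ≤ ENNReal.ofReal (b ^ q)) :
    Integrable (fun x => ‖x‖ ^ q) lam.totalVariation ∧
      ∫ x, ‖x‖ ^ q ∂lam.totalVariation ≤ b ^ q := by
  have hm : AEStronglyMeasurable (fun x : EuclideanSpace ℝ (Fin d) => ‖x‖ ^ q) lam.totalVariation :=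
    (continuous_norm.rpow_const (fun _ => Or.inr hq)).aestronglyMeasurable
  have e : ∀ x : EuclideanSpace ℝ (Fin d), ENNReal.ofReal (‖x‖ ^ q) = (‖x‖₊ : ℝ≥0∞) ^ q := by
    intro x
    rw [← ENNReal.ofReal_rpow_of_nonneg (norm_nonneg x) hq, ofReal_norm]
    rfl
  constructor
  · refine ⟨hm, ?_⟩
    rw [hasFiniteIntegral_iff_ofReal (Filter.Eventually.of_forall fun x => by positivity)]
    simp only [e]
    exact h.trans_lt ENNReal.ofReal_lt_top
  · rw [integral_eq_lintegral_of_nonneg_ae (Filter.Eventually.of_forall fun x => by positivity) hm]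
    simp only [e]
    exact ENNReal.toReal_le_of_le_ofReal (by positivity) h

instance : IsFiniteMeasure lam.totalVariation := by
  unfold SignedMeasure.totalVariation; infer_instance

lemma int_pow {q : ℝ} (hi : Integrable (fun x => ‖x‖ ^ q) lam.totalVariation) {k : ℕ}
    (hk : (k : ℝ) ≤ q) : Integrable (fun x => ‖x‖ ^ k) lam.totalVariation := by
  refine Integrable.mono' ((integrable_const (1 : ℝ)).add hi)
    (by fun_prop) (Filter.Eventually.of_forall fun x => ?_)
  rw [Real.norm_of_nonneg (by positivity)]
  simp only [Pi.add_apply]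
  have h0 : 0 ≤ ‖x‖ ^ q := by positivity
  rcases le_total ‖x‖ 1 with h | h
  · have := pow_le_one₀ (n := k) (norm_nonneg x) h
    linarith
  · have := Real.rpow_le_rpow_of_exponent_le h hk
    rw [Real.rpow_natCast] at this
    linarith

lemma int_monomial {q : ℝ} (hi : Integrable (fun x => ‖x‖ ^ q) lam.totalVariation)
    (α : Fin d → ℕ) (hk : ((∑ i, α i : ℕ) : ℝ) ≤ q) :
    Integrable (fun x : EuclideanSpace ℝ (Fin d) => ∏ i, x i ^ α i) lam.totalVariation := by
  refine Integrable.mono' (int_pow hi hk)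
    (by fun_prop) (Filter.Eventually.of_forall fun x => ?_)
  rw [norm_prod, ← Finset.prod_pow_eq_pow_sum]
  refine Finset.prod_le_prod (fun i _ => norm_nonneg _) fun i _ => ?_
  rw [norm_pow]
  gcongr
  exact PiLp.norm_apply_le x i

lemma tpoly_integral {q : ℝ} (hi : Integrable (fun x => ‖x‖ ^ q) lam.totalVariation) {p : ℕ}
    (hp : 1 ≤ p) (hpq : (p : ℝ) < q)
    (hmom : ∀ α : Fin d → ℕ, (∑ i, α i) ≤ p - 1 →
        sIntegral lam (fun x => ∏ i, x i ^ α i) = 0) (f : EE1 d → ℝ) :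
    Integrable (fun x => tpoly f p ((ee d).symm x)) lam.totalVariation ∧
    sIntegral lam (fun x => tpoly f p ((ee d).symm x)) = 0 := by
  obtain ⟨c, hc⟩ := tpoly_coord f p
  simp only [hc]
  have hcount : ∀ (k : ℕ) (I : Fin k → Fin d), ∑ i, (List.ofFn I).count i = k := by
    intro k I
    rw [← mi_length (fun i => (List.ofFn I).count i)]
    have hperm : (List.ofFn I).Perm (multiIndexDirs (fun i => (List.ofFn I).count i)) :=
      List.perm_iff_count.2 fun a => (mi_count (fun i => (List.ofFn I).count i) a).symm
    rw [← hperm.length_eq, List.length_ofFn]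
  have hint : ∀ k ∈ Finset.range p, ∀ I : Fin k → Fin d, Integrable
      (fun x : EuclideanSpace ℝ (Fin d) => c k I * ∏ i, x i ^ ((List.ofFn I).count i))
        lam.totalVariation := by
    intro k hk I
    refine (int_monomial hi _ ?_).const_mul _
    rw [hcount]
    have : (k : ℝ) ≤ p := by exact_mod_cast (Finset.mem_range.1 hk).le
    linarith
  constructor
  · exact integrable_finsetSum _ fun k hk => integrable_finsetSum _ fun I _ => hint k hk I
  · rw [sIntegral_sum _ (fun k hk => integrable_finsetSum _ fun I _ => hint k hk I)]
    refine Finset.sum_eq_zero fun k hk => ?_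
    rw [sIntegral_sum _ (fun I _ => hint k hk I)]
    refine Finset.sum_eq_zero fun I _ => ?_
    rw [sIntegral_const_mul, hmom, mul_zero]
    rw [hcount]
    have := Finset.mem_range.1 hk
    omega

end Integrals

/-- pointwise bound of functions vanishing to order `p` -/
lemma pt_bound {d p : ℕ} {V : EE1 d → ℝ}
    (hV : ContDiff ℝ (⊤ : ℕ∞) V) (hV0 : ∀ j < p, iteratedFDeriv ℝ j V 0 = 0)
    (hV1 : ∀ x, ‖iteratedFDeriv ℝ p V x‖ ≤ 1) (x : EuclideanSpace ℝ (Fin d)) :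
    |V ((ee d).symm x)| ≤ Real.sqrt d ^ p / (p.factorial : ℝ) * ‖x‖ ^ p := by
  have h := taylor_bound hV p hV0 hV1 p 0 (by omega) ((ee d).symm x)
  rw [norm_iteratedFDeriv_zero] at h
  refine h.trans ?_
  have h2 := norm_le_ee ((ee d).symm x)
  rw [ContinuousLinearEquiv.apply_symm_apply] at h2
  calc _ ≤ (Real.sqrt d * ‖x‖) ^ p / (p.factorial : ℝ) := by gcongr
    _ = _ := by ring

lemma mem_class_norm {d p : ℕ} {u : EuclideanSpace ℝ (Fin d) → ℝ} (hu : ContDiff ℝ (⊤ : ℕ∞) u)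
    (h1 : ∀ α : Fin d → ℕ, (∑ i, α i) = p → ∀ x, |mderiv α u x| ≤ 1) (y : EE1 d) :
    ‖iteratedFDeriv ℝ p (u ∘ ee d) y‖ ≤ 1 :=
  norm_iter_le hu p y 1 zero_le_one fun α hα => h1 α hα _

lemma restricted_bdd {d p : ℕ} (hp : 1 ≤ p) {r : ℝ} {lam : SignedMeasure (EuclideanSpace ℝ (Fin d))}
    (hi : Integrable (fun x => ‖x‖ ^ p) lam.totalVariation) :
    BddAbove { z | ∃ u : EuclideanSpace ℝ (Fin d) → ℝ, ContDiff ℝ (⊤ : ℕ∞) u ∧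
    Function.support u ⊆ Metric.closedBall 0 r ∧
    (∀ α : Fin d → ℕ, (∑ i, α i) ≤ p - 1 → mderiv α u 0 = 0) ∧
    (∀ α : Fin d → ℕ, (∑ i, α i) = p → ∀ x, |mderiv α u x| ≤ 1) ∧
    z = |sIntegral lam u| } := by
  refine ⟨∫ x, Real.sqrt d ^ p / (p.factorial : ℝ) * ‖x‖ ^ p ∂lam.totalVariation, ?_⟩
  rintro z ⟨u, hu, -, h0, h1, rfl⟩
  refine sIntegral_le (hi.const_mul _) fun x => ?_
  have := pt_bound (V := u ∘ ee d) (p := p) (hu.comp (ee d).contDiff) ?_ (mem_class_norm hu h1) x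
  · simpa using this
  · intro j hj
    rw [← norm_le_zero_iff]
    refine norm_iter_le hu j 0 0 le_rfl fun α hα => ?_
    rw [map_zero, h0 α (by omega), abs_zero]

theorem zolotarevSemi_le_restricted :
    ∃ c : ℝ, 0 < c ∧ ∀ (d p : ℕ), 1 ≤ p → ∀ (q b : ℝ), (p : ℝ) < q → 0 ≤ b →
    ∀ lam : SignedMeasure (EuclideanSpace ℝ (Fin d)),
      (∀ α : Fin d → ℕ, (∑ i, α i) ≤ p - 1 →
        sIntegral lam (fun x => ∏ i, x i ^ α i) = 0) →
      (∫⁻ x, (‖x‖₊ : ℝ≥0∞) ^ q ∂lam.totalVariation ≤ ENNReal.ofReal (b ^ q)) →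
      ∀ r : ℝ, 0 < r →
        zolotarevSemi p lam ≤
          c ^ p * (d : ℝ) ^ ((p : ℝ) / 2) * zolotarevSemiRestricted p r lam +
            (1 / (Nat.factorial p : ℝ)) * (d : ℝ) ^ (q / 2) * (2 / r) ^ (q - (p : ℝ)) *
              b ^ q := by
  refine ⟨2 * Real.exp 32, by positivity, ?_⟩
  intro d p hp q b hpq hb lam hmom hq r hr
  have hp0 : (0 : ℝ) ≤ p := by positivity
  obtain ⟨hi, hib⟩ := int_rpow (by linarith) hb hq
  have hip := int_pow hi hpq.le
  have hR0 : 0 ≤ zolotarevSemiRestricted p r lam := by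
    apply Real.sSup_nonneg
    rintro z ⟨u, -, -, -, -, rfl⟩
    exact abs_nonneg _
  apply Real.sSup_le _ (by positivity)
  rintro z ⟨u, hu, hu1, rfl⟩
  -- subtract the Taylor polynomial
  have hU : ContDiff ℝ (⊤ : ℕ∞) (u ∘ ee d) := hu.comp (ee d).contDiff
  set U : EE1 d → ℝ := u ∘ ee d with hUdef
  set V : EE1 d → ℝ := U - tpoly U p with hVdef
  have hT := tpoly_contDiff U p
  have hV : ContDiff ℝ (⊤ : ℕ∞) V := hU.sub hT
  have hsub : ∀ j x, iteratedFDeriv ℝ j V x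
      = iteratedFDeriv ℝ j U x - iteratedFDeriv ℝ j (tpoly U p) x := by
    intro j x
    exact iteratedFDeriv_sub_apply (hU.of_le (by exact_mod_cast le_top)).contDiffAt
      (hT.of_le (by exact_mod_cast le_top)).contDiffAt
  have hV0 : ∀ j < p, iteratedFDeriv ℝ j V 0 = 0 := by
    intro j hj
    rw [hsub, tpoly_deriv hU hj, sub_self]
  have hV1 : ∀ x, ‖iteratedFDeriv ℝ p V x‖ ≤ 1 := by
    intro x
    rw [hsub, tpoly_deriv_zero, sub_zero]
    exact mem_class_norm hu hu1 x
  have hVpt := pt_bound hV hV0 hV1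
  obtain ⟨hTi, hTz⟩ := tpoly_integral hi hp hpq hmom U
  let v : EuclideanSpace ℝ (Fin d) → ℝ := fun x => V ((ee d).symm x)
  have hvs : ContDiff ℝ (⊤ : ℕ∞) v := hV.comp (ee d).symm.contDiff
  have hvi : Integrable v lam.totalVariation := by
    refine Integrable.mono' (hip.const_mul _) hvs.continuous.aestronglyMeasurable
      (Filter.Eventually.of_forall fun x => hVpt x)
  have huv : sIntegral lam u = sIntegral lam v := by
    have : u = fun x => v x + tpoly U p ((ee d).symm x) := by
      funext x
      simp [v, hVdef, hUdef]
    rw [this, sIntegral_add hvi hTi, hTz, add_zero]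
  rw [huv]
  have hsq : Real.sqrt d ^ p = (d : ℝ) ^ ((p : ℝ) / 2) := by
    rw [Real.sqrt_eq_rpow, ← Real.rpow_natCast, ← Real.rpow_mul (by positivity)]
    congr 1; ring
  rcases Nat.eq_zero_or_pos d with hd | hd
  · have h0 : ∀ x, |v x| ≤ 0 := by
      intro x
      refine (hVpt x).trans (le_of_eq ?_)
      subst hd
      simp
      left; left; omega
    have := sIntegral_le (lam := lam) (f := v) (g := fun _ => 0) (by simp) h0
    simp only [integral_zero] at this
    exact this.trans (by positivity)
  · obtain ⟨w, hw, hw01, hw1, hw0, hwb⟩ := exists_cutoff d p hp r hr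
    have hprod := prod_bound hd hr hw hw0 hwb hV hV0 hV1
    set K : ℝ := (2 * Real.exp 32) ^ p * Real.sqrt d ^ p with hK
    have hKpos : 0 < K := by
      have : 0 < Real.sqrt d := Real.sqrt_pos.2 (by exact_mod_cast hd)
      positivity
    let W : EuclideanSpace ℝ (Fin d) → ℝ := fun x => w ((ee d).symm x)
    have hWs : ContDiff ℝ (⊤ : ℕ∞) W := hw.comp (ee d).symm.contDiff
    have hW01 : ∀ x, 0 ≤ W x ∧ W x ≤ 1 := fun x => hw01 _
    let f1 : EuclideanSpace ℝ (Fin d) → ℝ := fun x => K⁻¹ * (v x * W x)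
    let f2 : EuclideanSpace ℝ (Fin d) → ℝ := fun x => v x * (1 - W x)
    have hf1s : ContDiff ℝ (⊤ : ℕ∞) f1 := contDiff_const.mul (hvs.mul hWs)
    have hf1e : f1 ∘ ee d = K⁻¹ • (fun y => V y * w y) := by
      funext y
      simp [f1, v, W]
    have hvW : ContDiff ℝ (⊤ : ℕ∞) (fun y => V y * w y) := hV.mul hw
    have hf1d : ∀ j y, ‖iteratedFDeriv ℝ j (f1 ∘ ee d) y‖
        = K⁻¹ * ‖iteratedFDeriv ℝ j (fun y => V y * w y) y‖ := by
      intro j y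
      rw [hf1e, iteratedFDeriv_const_smul_apply (hvW.of_le (by exact_mod_cast le_top)).contDiffAt,
        norm_smul, Real.norm_of_nonneg (by positivity)]
    have hmem : |sIntegral lam f1| ≤ zolotarevSemiRestricted p r lam := by
      apply le_csSup (restricted_bdd hp hip)
      refine ⟨f1, hf1s, ?_, ?_, ?_, rfl⟩
      · intro x hx
        rw [mem_closedBall_zero_iff]
        by_contra hcon
        apply hx
        have : w ((ee d).symm x) = 0 := hw0 _ (by simpa using (not_le.1 hcon).le)
        simp [f1, W, this]
      · intro α hα
        have h := mderiv_le hf1s α 0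
        rw [map_zero, hf1d] at h
        have hev : (fun y => V y * w y) =ᶠ[nhds 0] V := by
          have ho : IsOpen {z : EE1 d | ‖ee d z‖ < r / 2} :=
            isOpen_lt (ee d).continuous.norm continuous_const
          filter_upwards [ho.mem_nhds (by simpa using hr)] with z hz
          rw [hw1 z (le_of_lt hz), mul_one]
        rw [(hev.iteratedFDeriv ℝ _).eq_of_nhds, hV0 _ (by omega), norm_zero, mul_zero] at h
        exact abs_nonpos_iff.1 h
      · intro α hα x
        have h := mderiv_le hf1s α ((ee d).symm x)
        rw [ContinuousLinearEquiv.apply_symm_apply, hf1d, hα] at h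
        refine h.trans ?_
        rw [inv_mul_le_iff₀ hKpos, mul_one]
        exact hprod _
    have hf2b : ∀ x, |f2 x| ≤ Real.sqrt d ^ p / (p.factorial : ℝ) * (2 / r) ^ (q - (p : ℝ)) * ‖x‖ ^ q := by
      intro x
      rcases le_or_gt ‖x‖ (r / 2) with hx | hx
      · have : W x = 1 := hw1 _ (by simpa using hx)
        simp only [f2, this, sub_self, mul_zero, abs_zero]
        positivity
      · have hxpos : 0 < ‖x‖ := by linarith [half_pos hr]
        have h1 : |f2 x| ≤ |v x| := by
          simp only [f2, abs_mul]
          have : |1 - W x| ≤ 1 := abs_le.2 ⟨by linarith [(hW01 x).2], by linarith [(hW01 x).1]⟩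
          exact mul_le_of_le_one_right (abs_nonneg _) this
        refine (h1.trans (hVpt x)).trans ?_
        rw [mul_assoc]
        refine mul_le_mul_of_nonneg_left ?_ (by positivity)
        have e : ‖x‖ ^ q = ‖x‖ ^ (q - (p : ℝ)) * ‖x‖ ^ p := by
          rw [← Real.rpow_natCast, ← Real.rpow_add hxpos]; congr 1; ring
        rw [e, ← mul_assoc, ← Real.mul_rpow (by positivity) (by positivity)]
        have : (1 : ℝ) ≤ (2 / r * ‖x‖) ^ (q - (p : ℝ)) := by
          apply Real.one_le_rpow _ (by linarith)
          rw [div_mul_eq_mul_div, le_div_iff₀ hr]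
          linarith
        exact le_mul_of_one_le_left (by positivity) this
    have hf2 : |sIntegral lam f2| ≤
        Real.sqrt d ^ p / (p.factorial : ℝ) * (2 / r) ^ (q - (p : ℝ)) * b ^ q := by
      refine (sIntegral_le (hi.const_mul _) hf2b).trans ?_
      rw [integral_const_mul]
      gcongr
    have hf1i : Integrable (fun x => v x * W x) lam.totalVariation := by
      refine Integrable.mono' hvi.norm (hvs.mul hWs).continuous.aestronglyMeasurable
        (Filter.Eventually.of_forall fun x => ?_)
      rw [norm_mul]
      refine mul_le_of_le_one_right (norm_nonneg _) ?_
      rw [Real.norm_of_nonneg (hW01 x).1]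
      exact (hW01 x).2
    have hf2i : Integrable f2 lam.totalVariation := by
      refine (hvi.sub hf1i).congr (Filter.Eventually.of_forall fun x => ?_)
      simp only [f2, Pi.sub_apply]; ring
    have hsplit : sIntegral lam v = K * sIntegral lam f1 + sIntegral lam f2 := by
      have : v = fun x => K * f1 x + f2 x := by
        funext x
        simp only [f1, f2]
        field_simp
        ring
      conv_lhs => rw [this]
      rw [sIntegral_add ((hf1i.const_mul _).const_mul _) hf2i, sIntegral_const_mul]
    rw [hsplit]
    refine (abs_add_le _ _).trans (add_le_add ?_ ?_)
    · rw [abs_mul, abs_of_pos hKpos, ← hsq]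
      gcongr
    · refine hf2.trans ?_
      have hle : Real.sqrt d ^ p ≤ (d : ℝ) ^ (q / 2) := by
        rw [hsq]
        exact Real.rpow_le_rpow_of_exponent_le (by exact_mod_cast hd) (by linarith)
      rw [one_div, inv_mul_eq_div]
      gcongr
end
end

section
/- Let p ≥ 1 be an integer and let μ, ν be Borel probability measures on ℝ^d with ∫|x|^p dμ(x) ≤ 1 and ∫|x|^p dν(x) ≤ 1, having equal mixed moments of all orders up to p−1 (∫ x^α dμ = ∫ x^α dν for all |α| ≤ p−1). Then ζ_p(μ,ν) ≤ 2 d^{p/2} / p!. -/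
open MeasureTheory
open scoped RealInnerProductSpace ENNReal NNReal

noncomputable section


/-- The Zolotarev distance of order `p` between (probability) measures on `ℝ^d`:
the supremum of `|∫ u dμ - ∫ u dν|` over all `C^∞`-smooth `u : ℝ^d → ℝ` whose
partial derivatives of order `p` are bounded by `1` in absolute value. -/
def zolotarevDist {d : ℕ} (p : ℕ) (μ ν : Measure (EuclideanSpace ℝ (Fin d))) : ℝ :=
  sSup { z | ∃ u : EuclideanSpace ℝ (Fin d) → ℝ, ContDiff ℝ (⊤ : ℕ∞) u ∧
    (∀ α : Fin d → ℕ, (∑ i, α i) = p → ∀ x, |mderiv α u x| ≤ 1) ∧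
    z = |(∫ x, u x ∂μ) - ∫ x, u x ∂ν| }


abbrev EE (d : ℕ) := EuclideanSpace ℝ (Fin d)

def DL {d : ℕ} (u : EE d → ℝ) : List (Fin d) → EE d → ℝ
  | [] => u
  | i :: L => fun y => fderiv ℝ (DL u L) y (EuclideanSpace.single i 1)

theorem DL_smooth {d : ℕ} {u : EE d → ℝ} (hu : ContDiff ℝ (⊤ : ℕ∞) u) (L : List (Fin d)) :
    ContDiff ℝ (⊤ : ℕ∞) (DL u L) := by
  induction L with
  | nil => exact hu
  | cons i L ih =>
    have h : ContDiff ℝ (⊤ : ℕ∞) (fderiv ℝ (DL u L)) := ih.fderiv_right (by simp)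
    exact h.clm_apply contDiff_const

theorem DL_perm {d : ℕ} {u : EE d → ℝ} (hu : ContDiff ℝ (⊤ : ℕ∞) u) {L L' : List (Fin d)}
    (h : L.Perm L') : DL u L = DL u L' := by
  induction h with
  | nil => rfl
  | cons x _ ih => simp only [DL, ih]
  | trans _ _ h1 h2 => exact h1.trans h2
  | swap a b L =>
    funext y
    have hs := DL_smooth hu L
    have h1 : ContDiff ℝ (⊤ : ℕ∞) (fderiv ℝ (DL u L)) := hs.fderiv_right (by simp)
    have hd : DifferentiableAt ℝ (fderiv ℝ (DL u L)) y := (h1.differentiable (by simp)) y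
    have key : ∀ v w : EE d, fderiv ℝ (fun z => fderiv ℝ (DL u L) z v) y w
        = fderiv ℝ (fderiv ℝ (DL u L)) y w v := by
      intro v w
      rw [fderiv_clm_apply hd (differentiableAt_const v)]
      simp
    have hsym : IsSymmSndFDerivAt ℝ (DL u L) y :=
      hs.contDiffAt.isSymmSndFDerivAt (by simp; exact WithTop.coe_le_coe.2 (le_top : (2 : ℕ∞) ≤ ⊤))
    simp only [DL, key]
    exact hsym.eq _ _

theorem iteratedFDeriv_eq_DL {d : ℕ} {u : EE d → ℝ} (hu : ContDiff ℝ (⊤ : ℕ∞) u) (n : ℕ)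
    (f : Fin n → Fin d) (y : EE d) :
    iteratedFDeriv ℝ n u y (fun k => EuclideanSpace.single (f k) 1) = DL u (List.ofFn f) y := by
  induction n generalizing y with
  | zero => simp [DL]
  | succ n ih =>
    rw [iteratedFDeriv_succ_apply_left, List.ofFn_succ]
    simp only [DL]
    have hd : DifferentiableAt ℝ (iteratedFDeriv ℝ n u) y :=
      (hu.differentiable_iteratedFDeriv (by exact_mod_cast WithTop.coe_lt_top _)) y
    have := funext (fun z => ih (fun k => f k.succ) z)
    rw [← this, fderiv_continuousMultilinear_apply_const_apply hd]
    rfl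

theorem mderiv_eq_DL {d : ℕ} {u : EE d → ℝ} (hu : ContDiff ℝ (⊤ : ℕ∞) u) (α : Fin d → ℕ)
    (y : EE d) : mderiv α u y = DL u (multiIndexDirs α) y := by
  unfold mderiv
  rw [iteratedFDeriv_eq_DL hu]
  congr 1
  exact List.ofFn_get _

theorem count_multiIndexDirs {d : ℕ} (α : Fin d → ℕ) (i : Fin d) :
    (multiIndexDirs α).count i = α i := by
  unfold multiIndexDirs
  rw [List.count_flatMap]
  have : (List.map (List.count i ∘ fun j => List.replicate (α j) j) (List.finRange d)).sum
      = ∑ j, (if j = i then α j else 0) := by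
    rw [← List.ofFn_eq_map, List.sum_ofFn]
    simp [List.count_replicate]
  rw [this]
  simp

def cnt {d n : ℕ} (f : Fin n → Fin d) (i : Fin d) : ℕ := (List.ofFn f).count i

theorem sum_cnt {d n : ℕ} (f : Fin n → Fin d) : ∑ i, cnt f i = n := by
  have := Multiset.sum_count_eq_card (s := Finset.univ) (m := (List.ofFn f : Multiset (Fin d)))
    (fun a _ => Finset.mem_univ a)
  simpa [cnt] using this

theorem prod_cnt {d n : ℕ} (f : Fin n → Fin d) (x : Fin d → ℝ) :
    ∏ k, x (f k) = ∏ i, x i ^ cnt f i := by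
  have h := Finset.prod_list_map_count (List.ofFn f) x
  rw [List.map_ofFn, List.prod_ofFn] at h
  simp only [Function.comp] at h
  rw [h]
  refine Finset.prod_subset (Finset.subset_univ _) ?_
  intro i _ hi
  rw [List.count_eq_zero_of_not_mem (by simpa using hi), pow_zero]

theorem DL_le {d p : ℕ} {u : EE d → ℝ} (hu : ContDiff ℝ (⊤ : ℕ∞) u)
    (hb : ∀ α : Fin d → ℕ, (∑ i, α i) = p → ∀ x, |mderiv α u x| ≤ 1)
    (f : Fin p → Fin d) (y : EE d) :
    |iteratedFDeriv ℝ p u y (fun k => EuclideanSpace.single (f k) 1)| ≤ 1 := by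
  rw [iteratedFDeriv_eq_DL hu, DL_perm hu (L' := multiIndexDirs (cnt f)), ← mderiv_eq_DL hu]
  · exact hb _ (sum_cnt f) y
  · rw [List.perm_iff_count]
    intro i
    rw [count_multiIndexDirs]; rfl

theorem expand {d n : ℕ} (M : ContinuousMultilinearMap ℝ (fun _ : Fin n => EE d) ℝ) (x : EE d) :
    M (fun _ => x) = ∑ f : Fin n → Fin d,
      (∏ k, x (f k)) * M (fun k => EuclideanSpace.single (f k) 1) := by
  have hx : x = ∑ i, x i • (EuclideanSpace.single i (1 : ℝ) : EE d) := by
    ext j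
    simp [Pi.single_apply]
  conv_lhs => rw [hx]
  rw [M.map_sum (fun _ i => x i • (EuclideanSpace.single i (1 : ℝ) : EE d))]
  refine Finset.sum_congr rfl fun f _ => ?_
  rw [M.map_smul_univ (fun k => x (f k)), smul_eq_mul]

theorem l1_bound {d : ℕ} (p : ℕ) (x : EE d) :
    (∑ i, |x i|) ^ p ≤ (d : ℝ) ^ ((p : ℝ) / 2) * ‖x‖ ^ p := by
  have h : ∑ i, |x i| ≤ √d * ‖x‖ := by
    rw [EuclideanSpace.norm_eq, ← Real.sqrt_mul (Nat.cast_nonneg d)]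
    apply Real.le_sqrt_of_sq_le
    simpa using sq_sum_le_card_mul_sum_sq (s := Finset.univ) (f := fun i => |x i|)
  have h2 : (√(d : ℝ)) ^ p = (d : ℝ) ^ ((p : ℝ) / 2) := by
    rw [Real.sqrt_eq_rpow, ← Real.rpow_natCast, ← Real.rpow_mul (Nat.cast_nonneg d)]
    congr 1; ring
  rw [← h2, ← mul_pow]
  exact pow_le_pow_left₀ (Finset.sum_nonneg fun i _ => abs_nonneg _) h p

theorem diag_bound {d p : ℕ} {u : EE d → ℝ} (hu : ContDiff ℝ (⊤ : ℕ∞) u)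
    (hb : ∀ α : Fin d → ℕ, (∑ i, α i) = p → ∀ x, |mderiv α u x| ≤ 1) (x y : EE d) :
    |iteratedFDeriv ℝ p u y (fun _ => x)| ≤ (d : ℝ) ^ ((p : ℝ) / 2) * ‖x‖ ^ p := by
  refine le_trans ?_ (l1_bound p x)
  rw [expand, Finset.sum_pow', Fintype.piFinset_univ]
  refine (Finset.abs_sum_le_sum_abs _ _).trans (Finset.sum_le_sum fun f _ => ?_)
  rw [abs_mul, Finset.abs_prod]
  exact mul_le_of_le_one_right (Finset.prod_nonneg fun _ _ => abs_nonneg _) (DL_le hu hb f y)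

def TP {d : ℕ} (u : EE d → ℝ) (p : ℕ) (x : EE d) : ℝ :=
  ∑ k ∈ Finset.range p, (k.factorial : ℝ)⁻¹ * ∑ f : Fin k → Fin d,
      (∏ j, x (f j)) * iteratedFDeriv ℝ k u 0 (fun j => EuclideanSpace.single (f j) 1)

theorem rem_bound {d p : ℕ} (hp : 1 ≤ p) {u : EE d → ℝ} (hu : ContDiff ℝ (⊤ : ℕ∞) u)
    (hb : ∀ α : Fin d → ℕ, (∑ i, α i) = p → ∀ x, |mderiv α u x| ≤ 1) (x : EE d) :
    |u x - TP u p x| ≤ (d : ℝ) ^ ((p : ℝ) / 2) / p.factorial * ‖x‖ ^ p := by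
  obtain ⟨n, rfl⟩ : ∃ n, p = n + 1 := ⟨p - 1, by omega⟩
  have ht := map_add_eq_sum_add_integral_iteratedFDeriv (f := u) (x := 0) (y := x) (n := n)
    (fun t _ => hu.contDiffAt.of_le (by exact_mod_cast le_top))
  have hT : TP u (n+1) x = ∑ k ∈ Finset.range (n + 1),
      ((k.factorial : ℕ) : ℝ)⁻¹ • (iteratedFDeriv ℝ k u 0 (fun _ ↦ x)) := by
    unfold TP
    exact Finset.sum_congr rfl fun k _ => by rw [expand, smul_eq_mul]
  rw [← hT] at ht
  simp only [zero_add] at ht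
  rw [ht, add_sub_cancel_left, smul_eq_mul, abs_mul, abs_of_nonneg (by positivity)]
  set C := (d : ℝ) ^ (((n + 1 : ℕ) : ℝ) / 2) * ‖x‖ ^ (n + 1) with hC
  have hI : ‖∫ t in (0:ℝ)..1, (1 - t)^n • iteratedFDeriv ℝ (n + 1) u (t • x) (fun _ ↦ x)‖
      ≤ |∫ t in (0:ℝ)..1, (1 - t)^n * C| := by
    apply intervalIntegral.norm_integral_le_abs_of_norm_le
    · refine (ae_restrict_iff' measurableSet_uIoc).2 (Filter.Eventually.of_forall fun t ht => ?_)
      rw [Set.uIoc_of_le zero_le_one] at ht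
      have h0 : 0 ≤ 1 - t := by linarith [ht.2]
      rw [norm_smul, Real.norm_of_nonneg (pow_nonneg h0 n), Real.norm_eq_abs]
      exact mul_le_mul_of_nonneg_left (diag_bound hu hb x _) (pow_nonneg h0 n)
    · exact Continuous.intervalIntegrable (by fun_prop) _ _
  have hJ : ∫ t in (0:ℝ)..1, (1 - t)^n * C = C / (n + 1) := by
    rw [intervalIntegral.integral_mul_const,
      intervalIntegral.integral_comp_sub_left (fun t => t ^ n) 1]
    simp
    ring
  rw [hJ, abs_of_nonneg (by positivity), Real.norm_eq_abs] at hI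
  calc _ ≤ (n.factorial : ℝ)⁻¹ * (C / (n + 1)) := by gcongr
    _ = _ := by
      rw [hC, Nat.factorial_succ]
      push_cast
      field_simp

theorem moment_facts {d p : ℕ} (μ : Measure (EE d)) [IsProbabilityMeasure μ]
    (hμ : ∫⁻ x, (‖x‖₊ : ℝ≥0∞) ^ p ∂μ ≤ 1) :
    Integrable (fun x : EE d => ‖x‖ ^ p) μ ∧ ∫ x, ‖x‖ ^ p ∂μ ≤ 1 := by
  have e : ∀ x : EE d, ENNReal.ofReal (‖x‖ ^ p) = (‖x‖₊ : ℝ≥0∞) ^ p := fun x => by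
    rw [ENNReal.ofReal_pow (norm_nonneg _), ofReal_norm]; rfl
  have hm : AEStronglyMeasurable (fun x : EE d => ‖x‖ ^ p) μ :=
    (by fun_prop : Continuous (fun x : EE d => ‖x‖ ^ p)).aestronglyMeasurable
  constructor
  · refine ⟨hm, ?_⟩
    rw [hasFiniteIntegral_iff_ofReal (Filter.Eventually.of_forall fun x => by positivity)]
    simp only [e]
    exact hμ.trans_lt ENNReal.one_lt_top
  · rw [integral_eq_lintegral_of_nonneg_ae (Filter.Eventually.of_forall fun x => by positivity) hm]
    simp only [e]
    exact ENNReal.toReal_le_of_le_ofReal zero_le_one (by simpa using hμ)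

theorem mono_int {d p k : ℕ} (hk : k < p) (μ : Measure (EE d)) [IsProbabilityMeasure μ]
    (hμ : Integrable (fun x : EE d => ‖x‖ ^ p) μ) (f : Fin k → Fin d) :
    Integrable (fun x : EE d => ∏ j, x (f j)) μ := by
  refine Integrable.mono' ((integrable_const (1:ℝ)).add hμ)
    (by fun_prop : Continuous (fun x : EE d => ∏ j, x (f j))).aestronglyMeasurable
    (Filter.Eventually.of_forall fun x => ?_)
  rw [norm_prod]
  have h1 : ∏ j, ‖x (f j)‖ ≤ ∏ _j : Fin k, ‖x‖ :=
    Finset.prod_le_prod (fun _ _ => norm_nonneg _) fun j _ => PiLp.norm_apply_le x (f j)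
  refine h1.trans ?_
  simp only [Finset.prod_const, Finset.card_univ, Fintype.card_fin, Pi.add_apply]
  rcases le_total ‖x‖ 1 with h | h
  · have := pow_le_one₀ (n := k) (norm_nonneg x) h
    have : 0 ≤ ‖x‖ ^ p := by positivity
    linarith
  · have := pow_le_pow_right₀ h hk.le
    linarith

theorem TP_int {d p : ℕ} (u : EE d → ℝ) (μ : Measure (EE d)) [IsProbabilityMeasure μ]
    (hμ : Integrable (fun x : EE d => ‖x‖ ^ p) μ) :
    Integrable (TP u p) μ ∧ ∫ x, TP u p x ∂μ = 
      ∑ k ∈ Finset.range p, (k.factorial : ℝ)⁻¹ * ∑ f : Fin k → Fin d,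
      (∫ x : EE d, ∏ i, x i ^ cnt f i ∂μ)
        * iteratedFDeriv ℝ k u 0 (fun j => EuclideanSpace.single (f j) 1) := by
  have h : ∀ k ∈ Finset.range p, ∀ f : Fin k → Fin d, Integrable (fun x : EE d => (∏ j, x (f j)) *
      iteratedFDeriv ℝ k u 0 (fun j => EuclideanSpace.single (f j) 1)) μ :=
    fun k hk f => (mono_int (Finset.mem_range.1 hk) μ hμ f).mul_const _
  have h' : ∀ k ∈ Finset.range p, Integrable (fun x : EE d =>
      (k.factorial : ℝ)⁻¹ * ∑ f : Fin k → Fin d, (∏ j, x (f j)) *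
      iteratedFDeriv ℝ k u 0 (fun j => EuclideanSpace.single (f j) 1)) μ :=
    fun k hk => (integrable_finsetSum _ fun f _ => h k hk f).const_mul _
  refine ⟨integrable_finsetSum _ h', ?_⟩
  unfold TP
  rw [integral_finsetSum _ h']
  refine Finset.sum_congr rfl fun k hk => ?_
  rw [integral_const_mul, integral_finsetSum _ fun f _ => h k hk f]
  congr 1
  refine Finset.sum_congr rfl fun f _ => ?_
  rw [integral_mul_const]
  simp only [fun x : EE d => prod_cnt f (fun i => x i)]

/-- **Inequality (7.1).** If `μ, ν` are probability measures on `ℝ^d` with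
`∫ |x|^p dμ ≤ 1`, `∫ |x|^p dν ≤ 1` and equal mixed moments up to order `p-1`, then
`ζ_p(μ,ν) ≤ 2 d^{p/2} / p!`. -/
theorem zolotarevDist_le_of_moments (d p : ℕ) (hp : 1 ≤ p)
    (μ ν : Measure (EuclideanSpace ℝ (Fin d)))
    [IsProbabilityMeasure μ] [IsProbabilityMeasure ν]
    (hμ : ∫⁻ x, (‖x‖₊ : ℝ≥0∞) ^ p ∂μ ≤ 1)
    (hν : ∫⁻ x, (‖x‖₊ : ℝ≥0∞) ^ p ∂ν ≤ 1)
    (hmom : ∀ α : Fin d → ℕ, (∑ i, α i) ≤ p - 1 →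
      (∫ x, ∏ i, x i ^ α i ∂μ) = ∫ x, ∏ i, x i ^ α i ∂ν) :
    zolotarevDist p μ ν ≤ 2 * (d : ℝ) ^ ((p : ℝ) / 2) / (Nat.factorial p : ℝ) := by
  obtain ⟨iμ, mμ⟩ := moment_facts μ hμ
  obtain ⟨iν, mν⟩ := moment_facts ν hν
  apply Real.sSup_le
  · rintro z ⟨u, hu, hb, rfl⟩
    have hu' : ContDiff ℝ (⊤ : ℕ∞) u := hu
    obtain ⟨tμ, eμ⟩ := TP_int (p := p) u μ iμ
    obtain ⟨tν, eν⟩ := TP_int (p := p) u ν iν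
    have hT : ∫ x, TP u p x ∂μ = ∫ x, TP u p x ∂ν := by
      rw [eμ, eν]
      refine Finset.sum_congr rfl fun k hk => ?_
      congr 1
      refine Finset.sum_congr rfl fun f _ => ?_
      rw [hmom (cnt f) (by rw [sum_cnt]; have := Finset.mem_range.1 hk; omega)]
    set K : ℝ := (d : ℝ) ^ ((p : ℝ) / 2) / p.factorial with hK
    have hK0 : 0 ≤ K := by positivity
    have key : ∀ (ρ : Measure (EuclideanSpace ℝ (Fin d))) [IsProbabilityMeasure ρ],
        Integrable (fun x => ‖x‖ ^ p) ρ → ∫ x, ‖x‖ ^ p ∂ρ ≤ 1 → Integrable (TP u p) ρ →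
        |(∫ x, u x ∂ρ) - ∫ x, TP u p x ∂ρ| ≤ K := by
      intro ρ _ h1 h2 h3
      have hc : Continuous (TP u p) := by unfold TP; fun_prop
      have hR : Integrable (fun x => u x - TP u p x) ρ :=
        Integrable.mono' (h1.const_mul K) (hu'.continuous.sub hc).aestronglyMeasurable
          (Filter.Eventually.of_forall fun x => rem_bound hp hu hb x)
      have hui : Integrable u ρ := by
        have := hR.add h3
        refine this.congr (Filter.Eventually.of_forall fun x => ?_)
        simp
      rw [← integral_sub hui h3, ← Real.norm_eq_abs]
      refine (norm_integral_le_of_norm_le (h1.const_mul K)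
        (Filter.Eventually.of_forall fun x => rem_bound hp hu hb x)).trans ?_
      rw [integral_const_mul]
      exact mul_le_of_le_one_right hK0 h2
    have a := abs_le.1 (key μ iμ mμ tμ)
    have b := abs_le.1 (key ν iν mν tν)
    have : 2 * (d : ℝ) ^ ((p : ℝ) / 2) / (Nat.factorial p : ℝ) = 2 * K := by rw [hK]; ring
    rw [this, abs_le]
    constructor <;> linarith [a.1, a.2, b.1, b.2]
  · positivity
end
end
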